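/- arXiv:0802.1228 — 2 statements merged into one kernel-verified Lean document; each statement's English description precedes it below -/
import Mathlib

section
/- Let r be a positive integer. The inversion operator ∇ on ℂ^{ℕ^r} is an involution: for every sequence a : ℕ^r → ℂ, ∇(∇a) = a. -/
/-- The difference operator `Δ_i` on sequences `ℕ^r → ℂ`:
`(Δ_i a)(n) = a(n) − a(n + e_i)`. -/
def delta (r : ℕ) (i : Fin r) (a : (Fin r → ℕ) → ℂ) : (Fin r → ℕ) → ℂ :=
  fun n => a n - a (Function.update n i (n i + 1))

/-- The composite `Δ_1^{k_1} ⋯ Δ_r^{k_r}`. -/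
def deltaIter (r : ℕ) (k : Fin r → ℕ) : ((Fin r → ℕ) → ℂ) → ((Fin r → ℕ) → ℂ) :=
  (List.ofFn (fun i : Fin r => (delta r i)^[k i])).foldr (· ∘ ·) id

/-- The inversion operator `∇`: `(∇a)(n) = (Δ_1^{n_1} ⋯ Δ_r^{n_r} a)(0,…,0)`. -/
def nabla (r : ℕ) (a : (Fin r → ℕ) → ℂ) : (Fin r → ℕ) → ℂ :=
  fun n => deltaIter r n a (fun _ => 0)

theorem delta_commute (r : ℕ) (i j : Fin r) : Function.Commute (delta r i) (delta r j) := by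
  intro a
  funext n
  rcases eq_or_ne i j with rfl | hij
  · rfl
  · simp only [delta, Function.update_of_ne hij, Function.update_of_ne hij.symm,
      Function.update_comm hij]
    ring

theorem delta_sub (r : ℕ) (i : Fin r) (a b : (Fin r → ℕ) → ℂ) :
    delta r i (a - b) = delta r i a - delta r i b := by
  funext n
  simp only [delta, Pi.sub_apply]
  ring

theorem delta_iterate_sub (r : ℕ) (i : Fin r) (m : ℕ) (a b : (Fin r → ℕ) → ℂ) :
    (delta r i)^[m] (a - b) = (delta r i)^[m] a - (delta r i)^[m] b := by
  induction m generalizing a b with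
  | zero => rfl
  | succ m ih => simp only [Function.iterate_succ_apply, delta_sub, ih]

/-- The composite of the iterates `Δ_j^{k_j}` for `j` running through a list. -/
def deltaList (r : ℕ) (k : Fin r → ℕ) (l : List (Fin r)) :
    ((Fin r → ℕ) → ℂ) → ((Fin r → ℕ) → ℂ) :=
  (l.map fun j => (delta r j)^[k j]).foldr (· ∘ ·) id

theorem deltaList_cons (r : ℕ) (k : Fin r → ℕ) (j : Fin r) (l : List (Fin r))
    (a : (Fin r → ℕ) → ℂ) :
    deltaList r k (j :: l) a = (delta r j)^[k j] (deltaList r k l a) := rfl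

theorem deltaIter_eq_deltaList (r : ℕ) (k : Fin r → ℕ) :
    deltaIter r k = deltaList r k (List.finRange r) := by
  rw [deltaIter, deltaList, List.ofFn_eq_map]

theorem deltaList_sub (r : ℕ) (k : Fin r → ℕ) (l : List (Fin r)) (a b : (Fin r → ℕ) → ℂ) :
    deltaList r k l (a - b) = deltaList r k l a - deltaList r k l b := by
  induction l with
  | nil => rfl
  | cons j l ih => simp only [deltaList_cons, ih, delta_iterate_sub]

theorem deltaList_zero (r : ℕ) (l : List (Fin r)) (a : (Fin r → ℕ) → ℂ) :
    deltaList r (fun _ => 0) l a = a := by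
  induction l with
  | nil => rfl
  | cons j l ih => rw [deltaList_cons, ih, Function.iterate_zero_apply]

theorem deltaList_delta (r : ℕ) (k : Fin r → ℕ) (l : List (Fin r)) (i : Fin r)
    (a : (Fin r → ℕ) → ℂ) :
    deltaList r k l (delta r i a) = delta r i (deltaList r k l a) := by
  induction l with
  | nil => rfl
  | cons j l ih =>
    rw [deltaList_cons, deltaList_cons, ih]
    exact ((delta_commute r j i).iterate_left (k j)) _

theorem deltaList_update_of_notMem (r : ℕ) (k : Fin r → ℕ) {l : List (Fin r)} {i : Fin r}
    (hi : i ∉ l) (m : ℕ) : deltaList r (Function.update k i m) l = deltaList r k l := by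
  unfold deltaList
  congr 1
  refine List.map_congr_left fun j hj => ?_
  rw [Function.update_of_ne (ne_of_mem_of_not_mem hj hi)]

theorem deltaList_update_succ (r : ℕ) (k : Fin r → ℕ) {l : List (Fin r)} (hl : l.Nodup)
    {i : Fin r} (hi : i ∈ l) (a : (Fin r → ℕ) → ℂ) :
    deltaList r (Function.update k i (k i + 1)) l a = delta r i (deltaList r k l a) := by
  induction l with
  | nil => simp at hi
  | cons j l ih =>
    rw [List.nodup_cons] at hl
    rw [deltaList_cons, deltaList_cons]
    rcases eq_or_ne i j with rfl | hij
    · rw [deltaList_update_of_notMem r k hl.1, Function.update_self,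
        Function.iterate_succ_apply']
    · rw [ih hl.2 (List.mem_of_ne_of_mem hij hi), Function.update_of_ne hij.symm]
      exact ((delta_commute r j i).iterate_left (k j)) _

theorem nabla_delta (r : ℕ) (i : Fin r) (a : (Fin r → ℕ) → ℂ) (n : Fin r → ℕ) :
    nabla r (delta r i a) n = nabla r a (Function.update n i (n i + 1)) := by
  simp only [nabla, deltaIter_eq_deltaList, deltaList_delta,
    deltaList_update_succ r n (List.nodup_finRange r) (List.mem_finRange i)]

theorem nabla_shift (r : ℕ) (i : Fin r) (a : (Fin r → ℕ) → ℂ) :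
    nabla r (fun n => a (Function.update n i (n i + 1))) = delta r i (nabla r a) := by
  have h : (fun n => a (Function.update n i (n i + 1))) = a - delta r i a := by
    funext n
    simp [delta]
  funext n
  rw [h, delta, ← nabla_delta]
  simp only [nabla, deltaIter_eq_deltaList, deltaList_sub, Pi.sub_apply]

theorem nabla_zero (r : ℕ) (a : (Fin r → ℕ) → ℂ) :
    nabla r a (fun _ => 0) = a (fun _ => 0) := by
  rw [nabla, deltaIter_eq_deltaList, deltaList_zero]

theorem nabla_nabla_update (r : ℕ) (i : Fin r) (a : (Fin r → ℕ) → ℂ) (n : Fin r → ℕ) :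
    nabla r (nabla r a) (Function.update n i (n i + 1)) =
      nabla r (nabla r fun m => a (Function.update m i (m i + 1))) n := by
  rw [nabla_shift, nabla_delta]

theorem nabla_nabla_apply (r : ℕ) (a : (Fin r → ℕ) → ℂ) (n : Fin r → ℕ) :
    nabla r (nabla r a) n = a n := by
  induction hs : ∑ j, n j generalizing n a with
  | zero =>
    have hn : n = fun _ => 0 := by
      funext j
      exact (Finset.sum_eq_zero_iff.mp hs) j (Finset.mem_univ j)
    rw [hn, nabla_zero, nabla_zero]
  | succ s ih =>
    obtain ⟨i, -, hi⟩ := Finset.exists_ne_zero_of_sum_ne_zero (hs.trans_ne s.succ_ne_zero)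
    obtain ⟨m, rfl⟩ : ∃ m : Fin r → ℕ, n = Function.update m i (m i + 1) := by
      refine ⟨Function.update n i (n i - 1), ?_⟩
      rw [Function.update_idem, Function.update_self,
        Nat.sub_add_cancel (Nat.one_le_iff_ne_zero.mpr hi), Function.update_eq_self]
    rw [nabla_nabla_update, ih]
    rw [Finset.sum_update_of_mem (Finset.mem_univ i)] at hs
    rw [← Finset.add_sum_erase _ _ (Finset.mem_univ i), Finset.erase_eq]
    omega

/-- the inversion operator `∇` is an involution: `∇(∇a) = a`. -/
theorem stmt2 (r : ℕ) (hr : 0 < r) (a : (Fin r → ℕ) → ℂ) :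
    nabla r (nabla r a) = a := by
  funext n
  exact nabla_nabla_apply r a n
end

section
/- Fix positive integers r and p. Let x_1,…,x_r ∈ ℂ^p and t_1,…,t_{p−1} ∈ ℂ ∖ {0,−1,−2,…}. Then for all n_1,…,n_r, k_1,…,k_r ∈ ℕ: (Δ_1^{k_1} ⋯ Δ_r^{k_r} c^{t_1,…,t_{p−1}}_{x_1;⋯;x_r})(n_1,…,n_r) = c^{t_1,…,t_{p−1}}_{x_1;⋯;x_r;1−x_1;⋯;1−x_r}(n_1,…,n_r,k_1,…,k_r), where on the right-hand side the nested sum is taken with 2r sequences of parameters x_1,…,x_r,1−x_1,…,1−x_r ∈ ℂ^p (and 1−x = (1−x_1,…,1−x_p) for x = (x_1,…,x_p) ∈ ℂ^p). -/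
open Finset

/-- The generalized binomial coefficient `binom(z,k) = z(z−1)⋯(z−k+1)/k!`
for `z ∈ ℂ` and `k ∈ ℕ`. -/
noncomputable def gbinom (z : ℂ) (k : ℕ) : ℂ :=
  (∏ i ∈ Finset.range k, (z - (i : ℂ))) / (Nat.factorial k : ℂ)

/-- Given the increments `ν = (ν_1,…,ν_p)` of a weakly decreasing chain
`n_1 ≥ n_2 ≥ ⋯ ≥ n_p ≥ 0` (so `ν_j = n_j − n_{j+1}` for `j < p` and `ν_p = n_p`),
`tailSum ν j = ν_j + ν_{j+1} + ⋯ + ν_p` recovers `n_j`. -/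
def tailSum {p : ℕ} (ν : Fin p → ℕ) (j : Fin p) : ℕ :=
  ∑ l : Fin p, if j ≤ l then ν l else 0

/-- The nested sum `c^{t_1,…,t_{p−1}}_{x_1;⋯;x_r}(n_1,…,n_r)`: the sum over all
chains `n_i = n_{i1} ≥ n_{i2} ≥ ⋯ ≥ n_{ip} ≥ 0` (for each `1 ≤ i ≤ r`),
parametrized by their increment vectors `ν i ∈ antidiagonalTuple p (n i)`, of
`[∏_i multinomial(n_i; ν_{i1},…,ν_{ip}) · x_{i1}^{ν_{i1}} ⋯ x_{ip}^{ν_{ip}}] /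
 [∏_{j=1}^{p−1} binom(n_{1j}+⋯+n_{rj}+t_j−1, ν_{1j}+⋯+ν_{rj}) · (n_{1j}+⋯+n_{rj}+t_j)]`. -/
noncomputable def nestedC (r p : ℕ) (x : Fin r → Fin p → ℂ) (t : Fin (p - 1) → ℂ)
    (n : Fin r → ℕ) : ℂ :=
  ∑ ν ∈ Fintype.piFinset (fun i : Fin r => Finset.Nat.antidiagonalTuple p (n i)),
    (∏ i : Fin r,
      ((Nat.multinomial Finset.univ (ν i) : ℂ) * ∏ j : Fin p, x i j ^ ν i j)) /
    (∏ j : Fin (p - 1),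
      (gbinom
          ((∑ i : Fin r,
            (tailSum (ν i) ⟨j.1, lt_of_lt_of_le j.2 (Nat.sub_le p 1)⟩ : ℕ) : ℂ)
            + t j - 1)
          (∑ i : Fin r, ν i ⟨j.1, lt_of_lt_of_le j.2 (Nat.sub_le p 1)⟩) *
        ((∑ i : Fin r,
            (tailSum (ν i) ⟨j.1, lt_of_lt_of_le j.2 (Nat.sub_le p 1)⟩ : ℕ) : ℂ)
          + t j)))

lemma gbinom_succ_right (z : ℂ) (k : ℕ) :
    gbinom z (k + 1) * (k + 1) = gbinom z k * (z - k) := by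
  have hk : (k : ℂ) + 1 ≠ 0 := by exact_mod_cast k.succ_ne_zero
  have hf : (k.factorial : ℂ) ≠ 0 := by exact_mod_cast k.factorial_ne_zero
  simp only [gbinom, prod_range_succ, Nat.factorial_succ]
  push_cast
  field_simp

lemma gbinom_succ_succ (z : ℂ) (k : ℕ) :
    gbinom (z + 1) (k + 1) * (k + 1) = gbinom z k * (z + 1) := by
  have hk : (k : ℂ) + 1 ≠ 0 := by exact_mod_cast k.succ_ne_zero
  have hf : (k.factorial : ℂ) ≠ 0 := by exact_mod_cast k.factorial_ne_zero
  simp only [gbinom, prod_range_succ', Nat.factorial_succ]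
  push_cast
  simp only [add_sub_add_right_eq_sub, sub_zero]
  field_simp

lemma gbinom_add_sub_one_ne_zero {t : ℂ} (ht : ∀ m : ℕ, t ≠ -(m : ℂ)) {a N : ℕ} (h : a ≤ N) :
    gbinom ((N : ℂ) + t - 1) a ≠ 0 := by
  refine div_ne_zero (prod_ne_zero_iff.2 fun i hi h0 => ?_)
    (by exact_mod_cast a.factorial_ne_zero)
  obtain ⟨d, rfl⟩ := Nat.exists_eq_add_of_lt ((mem_range.1 hi).trans_le h)
  apply ht d
  push_cast at h0
  linear_combination h0

/-- The factor `1 / (binom(N+t-1, a) (N+t))`, equal to the Beta integral `B(a+1, N-a+t)`. -/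
noncomputable def betaFactor (t : ℂ) (a N : ℕ) : ℂ :=
  (gbinom ((N : ℂ) + t - 1) a * ((N : ℂ) + t))⁻¹

lemma betaFactor_add {t : ℂ} (ht : ∀ m : ℕ, t ≠ -(m : ℂ)) {a N : ℕ} (h : a ≤ N) :
    betaFactor t (a + 1) (N + 1) + betaFactor t a (N + 1) = betaFactor t a N := by
  have hG := gbinom_add_sub_one_ne_zero ht h
  have hG1 := gbinom_add_sub_one_ne_zero ht (Nat.succ_le_succ h)
  have hG2 := gbinom_add_sub_one_ne_zero ht (h.trans N.le_succ)
  have hs : (N : ℂ) + t ≠ 0 := fun h0 => ht N (by linear_combination h0)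
  have hs1 : (N : ℂ) + 1 + t ≠ 0 := fun h0 => ht (N + 1) (by push_cast; linear_combination h0)
  have e1 := gbinom_succ_succ ((N : ℂ) + t - 1) a
  have e2 := gbinom_succ_right ((N : ℂ) + t - 1 + 1) a
  simp only [betaFactor]
  push_cast at hG1 hG2 ⊢
  rw [show (N : ℂ) + 1 + t - 1 = (N : ℂ) + t - 1 + 1 by ring] at *
  generalize gbinom ((N : ℂ) + t - 1) a = G at *
  generalize gbinom ((N : ℂ) + t - 1 + 1) (a + 1) = G1 at *
  generalize gbinom ((N : ℂ) + t - 1 + 1) a = G2 at *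
  have i1 : G1⁻¹ = (a + 1) / (G * (N + t)) := by
    field_simp
    linear_combination -e1
  have i2 : G2⁻¹ = ((N : ℂ) + t - a) / (G * (N + t)) := by
    field_simp
    linear_combination e2 - e1
  rw [mul_inv, mul_inv, i1, i2]
  field_simp
  ring

lemma tailSum_zero {q : ℕ} (ν : Fin (q + 1) → ℕ) : tailSum ν 0 = ∑ l, ν l := by
  simp [tailSum]

lemma tailSum_succ {q : ℕ} (ν : Fin (q + 1) → ℕ) (j : Fin q) :
    tailSum ν j.succ = tailSum (fun l => ν l.succ) j := by
  simp [tailSum, Fin.sum_univ_succ]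

lemma tailSum_sum {ι : Type*} {p : ℕ} (s : Finset ι) (ν : ι → Fin p → ℕ) (j : Fin p) :
    tailSum (∑ i ∈ s, ν i) j = ∑ i ∈ s, tailSum (ν i) j := by
  simp only [tailSum]
  rw [sum_comm]
  refine sum_congr rfl fun l _ => ?_
  split_ifs <;> simp

/-- The moments of the stick-breaking Beta distribution with parameters `t`. -/
noncomputable def betaMoment {q : ℕ} (t : Fin q → ℂ) (ν : Fin (q + 1) → ℕ) : ℂ :=
  ∏ j : Fin q, betaFactor (t j) (ν j.castSucc) (tailSum ν j.castSucc)

lemma betaMoment_succ {q : ℕ} (t : Fin (q + 1) → ℂ) (ν : Fin (q + 2) → ℕ) :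
    betaMoment t ν = betaFactor (t 0) (ν 0) (∑ l, ν l) *
      betaMoment (fun j => t j.succ) (fun l => ν l.succ) := by
  simp only [betaMoment, Fin.prod_univ_succ, Fin.castSucc_zero, tailSum_zero,
    Fin.castSucc_succ, tailSum_succ]

lemma sum_betaMoment_add_single {q : ℕ} (t : Fin q → ℂ) (ht : ∀ j (m : ℕ), t j ≠ -(m : ℂ))
    (ν : Fin (q + 1) → ℕ) :
    ∑ l, betaMoment t (ν + Pi.single l 1) = betaMoment t ν := by
  induction q with
  | zero => simp [betaMoment]
  | succ q ih =>
    have hsum (l : Fin (q + 2)) :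
        ∑ i, (ν + Pi.single l 1 : Fin (q + 2) → ℕ) i = (∑ i, ν i) + 1 := by
      simp [sum_add_distrib]
    have h0 : (fun i : Fin (q + 1) => (ν + Pi.single 0 1 : Fin (q + 2) → ℕ) i.succ) = fun i => ν i.succ := by
      ext i; simp
    have hs (l : Fin (q + 1)) : (fun i : Fin (q + 1) =>
        (ν + Pi.single l.succ 1 : Fin (q + 2) → ℕ) i.succ) =
        (fun i => ν i.succ) + Pi.single l 1 := by
      ext i; simp [Pi.single_apply]
    rw [Fin.sum_univ_succ]
    simp only [betaMoment_succ, hsum, h0, hs]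
    rw [← betaFactor_add (ht 0) (single_le_sum (fun _ _ => Nat.zero_le _) (mem_univ 0))]
    simp [← mul_sum, ih (fun j => t j.succ) (fun j => ht j.succ), add_mul]

/-- The linear functional on polynomials given by the moments `betaMoment t`. -/
noncomputable def betaFunctional {q : ℕ} (t : Fin q → ℂ) :
    MvPolynomial (Fin (q + 1)) ℂ →ₗ[ℂ] ℂ :=
  (MvPolynomial.basisMonomials (Fin (q + 1)) ℂ).constr ℂ fun m => betaMoment t m

lemma betaFunctional_monomial {q : ℕ} (t : Fin q → ℂ) (m : Fin (q + 1) →₀ ℕ) (c : ℂ) :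
    betaFunctional t (MvPolynomial.monomial m c) = c * betaMoment t m := by
  have h := (MvPolynomial.basisMonomials (Fin (q + 1)) ℂ).constr_basis ℂ
    (fun m => betaMoment t m) m
  rw [MvPolynomial.coe_basisMonomials] at h
  rw [← mul_one c, ← smul_eq_mul, ← MvPolynomial.smul_monomial, map_smul, betaFunctional, h]
  simp

lemma betaFunctional_mul_sum_X {q : ℕ} (t : Fin q → ℂ) (ht : ∀ j (m : ℕ), t j ≠ -(m : ℂ))
    (f : MvPolynomial (Fin (q + 1)) ℂ) :
    betaFunctional t (f * ∑ l, MvPolynomial.X l) = betaFunctional t f := by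
  induction f using MvPolynomial.induction_on' with
  | monomial m c =>
    simp only [mul_sum, MvPolynomial.X, MvPolynomial.monomial_mul, mul_one, map_sum,
      betaFunctional_monomial]
    rw [← mul_sum, ← sum_betaMoment_add_single t ht]
    simp [Finsupp.single_eq_pi_single]
  | add f g hf hg => rw [add_mul, map_add, map_add, hf, hg]

/-- The linear form `∑ j, x_j X_j`. -/
noncomputable def linForm {p : ℕ} (x : Fin p → ℂ) : MvPolynomial (Fin p) ℂ :=
  ∑ j, MvPolynomial.C (x j) * MvPolynomial.X j

lemma linForm_one_sub {p : ℕ} (x : Fin p → ℂ) :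
    linForm (fun j => 1 - x j) = (∑ j, MvPolynomial.X j) - linForm x := by
  simp [linForm, sub_mul, sum_sub_distrib]

lemma linForm_pow {p : ℕ} (x : Fin p → ℂ) (n : ℕ) :
    linForm x ^ n = ∑ ν ∈ Finset.Nat.antidiagonalTuple p n,
      MvPolynomial.monomial (Finsupp.equivFunOnFinite.symm ν)
        ((Nat.multinomial univ ν : ℂ) * ∏ j, x j ^ ν j) := by
  have h : Finset.Nat.antidiagonalTuple p n = piAntidiag univ n := by
    ext ν; simp [Finset.Nat.mem_antidiagonalTuple]
  rw [linForm, sum_pow_eq_sum_piAntidiag, h]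
  refine sum_congr rfl fun ν _ => ?_
  rw [MvPolynomial.monomial_eq, Finsupp.prod_fintype _ _ (by simp)]
  simp [mul_pow, prod_mul_distrib, mul_assoc]

lemma nestedC_eq_betaFunctional (r q : ℕ) (x : Fin r → Fin (q + 1) → ℂ) (t : Fin q → ℂ)
    (n : Fin r → ℕ) :
    nestedC r (q + 1) x t n = betaFunctional t (∏ i, linForm (x i) ^ n i) := by
  simp only [linForm_pow, prod_univ_sum, map_sum]
  refine sum_congr rfl fun ν _ => ?_
  rw [← MvPolynomial.monomial_sum_prod, betaFunctional_monomial, div_eq_mul_inv,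
    ← prod_inv_distrib]
  congr 1
  have h : (⇑(∑ i, Finsupp.equivFunOnFinite.symm (ν i)) : Fin (q + 1) → ℕ) = ∑ i, ν i := by
    simp
  rw [h]
  refine prod_congr rfl fun j _ => ?_
  rw [betaFactor, tailSum_sum, Finset.sum_apply]
  push_cast
  rfl

lemma delta_betaFunctional {q r : ℕ} {t : Fin q → ℂ} (ht : ∀ j (m : ℕ), t j ≠ -(m : ℂ))
    (x : Fin r → Fin (q + 1) → ℂ) (f : MvPolynomial (Fin (q + 1)) ℂ) (i : Fin r) :
    delta r i (fun n => betaFunctional t (f * ∏ i, linForm (x i) ^ n i)) =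
      fun n => betaFunctional t
        (f * linForm (fun j => 1 - x i j) * ∏ i, linForm (x i) ^ n i) := by
  ext n
  have h : ∏ l, linForm (x l) ^ (Function.update n i (n i + 1)) l =
      linForm (x i) * ∏ l, linForm (x l) ^ n l := by
    rw [← mul_prod_erase univ _ (mem_univ i), ← mul_prod_erase univ (fun l => linForm (x l) ^ n l)
      (mem_univ i), Function.update_self, pow_succ', mul_assoc]
    congr 2
    exact prod_congr rfl fun l hl => by rw [Function.update_of_ne (ne_of_mem_erase hl)]
  rw [delta, h, ← betaFunctional_mul_sum_X t ht, ← map_sub, linForm_one_sub]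
  congr 1
  ring

lemma delta_iterate_betaFunctional {q r : ℕ} {t : Fin q → ℂ}
    (ht : ∀ j (m : ℕ), t j ≠ -(m : ℂ)) (x : Fin r → Fin (q + 1) → ℂ)
    (f : MvPolynomial (Fin (q + 1)) ℂ) (i : Fin r) (k : ℕ) :
    (delta r i)^[k] (fun n => betaFunctional t (f * ∏ i, linForm (x i) ^ n i)) =
      fun n => betaFunctional t
        (f * linForm (fun j => 1 - x i j) ^ k * ∏ i, linForm (x i) ^ n i) := by
  induction k with
  | zero => simp
  | succ k ih =>
    rw [Function.iterate_succ_apply', ih, delta_betaFunctional ht]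
    simp only [pow_succ, mul_assoc]

lemma foldr_delta_betaFunctional {q r : ℕ} {t : Fin q → ℂ}
    (ht : ∀ j (m : ℕ), t j ≠ -(m : ℂ)) (x : Fin r → Fin (q + 1) → ℂ) (k : Fin r → ℕ)
    (l : List (Fin r)) :
    (l.map fun i => (delta r i)^[k i]).foldr (· ∘ ·) id
        (fun n => betaFunctional t (∏ i, linForm (x i) ^ n i)) =
      fun n => betaFunctional t ((l.map fun i => linForm (fun j => 1 - x i j) ^ k i).prod *
        ∏ i, linForm (x i) ^ n i) := by
  induction l with
  | nil => simp
  | cons i l ih =>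
    simp only [List.map_cons, List.foldr_cons, Function.comp_apply, List.prod_cons]
    rw [ih, delta_iterate_betaFunctional ht]
    simp only [mul_comm]

/-- the difference formula, Corollary 3 of the paper:
`(Δ_1^{k_1} ⋯ Δ_r^{k_r} c^{t_1,…,t_{p−1}}_{x_1;⋯;x_r})(n_1,…,n_r)
 = c^{t_1,…,t_{p−1}}_{x_1;⋯;x_r;1−x_1;⋯;1−x_r}(n_1,…,n_r,k_1,…,k_r)`. -/
theorem stmt13 (r p : ℕ) (hr : 0 < r) (hp : 0 < p)
    (x : Fin r → Fin p → ℂ) (t : Fin (p - 1) → ℂ)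
    (ht : ∀ (j : Fin (p - 1)) (m : ℕ), t j ≠ -(m : ℂ))
    (n k : Fin r → ℕ) :
    deltaIter r k (nestedC r p x t) n
      = nestedC (r + r) p (Fin.append x (fun i j => 1 - x i j)) t (Fin.append n k) := by
  obtain ⟨q, rfl⟩ : ∃ q, p = q + 1 := ⟨p - 1, by omega⟩
  change Fin q → ℂ at t
  have hfun : nestedC r (q + 1) x t =
      fun n => betaFunctional t (∏ i, linForm (x i) ^ n i) :=
    funext fun n => nestedC_eq_betaFunctional r q x t n
  rw [deltaIter, List.ofFn_eq_map, hfun, foldr_delta_betaFunctional ht,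
    nestedC_eq_betaFunctional, Fin.prod_univ_add, ← List.ofFn_eq_map, List.prod_ofFn, mul_comm]
  simp only [Fin.append_left, Fin.append_right]
  rfl
end
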